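/- Let M be a positively t-determined S-module with r^*M ≠ 0. If M is sequentially Cohen-Macaulay, then r^*M is sequentially Cohen-Macaulay. -/

import Mathlib

open MvPolynomial

noncomputable def mono (K : Type) [Field K] {n : ℕ} (a : Fin n → ℕ) : MvPolynomial (Fin n) K :=
  monomial (Finsupp.equivFunOnFinite.symm a) 1

def rmap {n : ℕ} (t a : Fin n → ℕ) : Fin n → ℕ := fun i => if 0 < a i then t i else 0

def sqrtv {n : ℕ} (a : Fin n → ℕ) : Fin n → ℕ := fun i => if 0 < a i then 1 else 0

structure MultiGrading (K : Type) [Field K] (n : ℕ) (M : Type) [AddCommGroup M]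
    [Module (MvPolynomial (Fin n) K) M] [Module K M]
    [IsScalarTower K (MvPolynomial (Fin n) K) M] where
  g : (Fin n → ℕ) → Submodule K M
  internal : DirectSum.IsInternal g
  compat : ∀ a b : Fin n → ℕ, ∀ m ∈ g a, mono K b • m ∈ g (a + b)

variable {K : Type} [Field K] {n : ℕ}

def PosDetermined {M : Type} [AddCommGroup M] [Module (MvPolynomial (Fin n) K) M] [Module K M]
    [IsScalarTower K (MvPolynomial (Fin n) K) M] (G : MultiGrading K n M) (t : Fin n → ℕ) : Prop :=
  ∀ (a : Fin n → ℕ) (i : Fin n), t i ≤ a i →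
    Set.BijOn (fun m => (X i : MvPolynomial (Fin n) K) • m) (G.g a : Set M) (G.g (a + Pi.single i 1) : Set M)

def IsRStar {M N : Type} [AddCommGroup M] [Module (MvPolynomial (Fin n) K) M] [Module K M]
    [IsScalarTower K (MvPolynomial (Fin n) K) M]
    [AddCommGroup N] [Module (MvPolynomial (Fin n) K) N] [Module K N]
    [IsScalarTower K (MvPolynomial (Fin n) K) N]
    (t : Fin n → ℕ) (G : MultiGrading K n M) (H : MultiGrading K n N) : Prop :=
  ∃ e : (Fin n → ℕ) → (M →ₗ[K] N),
    (∀ a, Set.InjOn (e a) (G.g (rmap t a))) ∧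
    (∀ a, e a '' (G.g (rmap t a)) = (H.g a : Set N)) ∧
    (∀ a b : Fin n → ℕ, ∀ m ∈ G.g (rmap t a),
      e (a + b) (mono K (rmap t (a + b) - rmap t a) • m) = mono K b • e a m)

noncomputable def mdim (R : Type) [CommRing R] (M : Type) [AddCommGroup M] [Module R M] :
    WithBot ℕ∞ :=
  ringKrullDim (R ⧸ (⊤ : Submodule R M).annihilator)

noncomputable def mdepth (K : Type) [Field K] (n : ℕ) (M : Type) [AddCommGroup M] [Module (MvPolynomial (Fin n) K) M] : ℕ :=
  sSup {k : ℕ | ∃ rs : List (MvPolynomial (Fin n) K), rs.length = k ∧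
    (∀ r ∈ rs, r ∈ Ideal.span (Set.range (X : Fin n → MvPolynomial (Fin n) K))) ∧
    RingTheory.Sequence.IsRegular M rs}

noncomputable def IsCM (K : Type) [Field K] (n : ℕ) (M : Type) [AddCommGroup M] [Module (MvPolynomial (Fin n) K) M] : Prop :=
  (mdepth K n M : WithBot ℕ∞) = mdim (MvPolynomial (Fin n) K) M

/-- The subquotient `p'/p` of a module, for submodules `p p' : Submodule R M`. -/
abbrev subquotient {R M : Type} [CommRing R] [AddCommGroup M] [Module R M]
    (p p' : Submodule R M) : Type :=
  ↥p' ⧸ Submodule.comap p'.subtype p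

/-- A graded module is sequentially Cohen-Macaulay if it has a finite filtration by graded
submodules whose successive quotients are Cohen-Macaulay of strictly increasing dimension. -/
noncomputable def IsSeqCM {M : Type} [AddCommGroup M] [Module (MvPolynomial (Fin n) K) M]
    [Module K M] [IsScalarTower K (MvPolynomial (Fin n) K) M]
    (G : MultiGrading K n M) : Prop :=
  ∃ (r : ℕ) (c : Fin (r + 1) → Submodule (MvPolynomial (Fin n) K) M),
    c 0 = ⊥ ∧ c (Fin.last r) = ⊤ ∧
    (∀ i : Fin r, c i.castSucc < c i.succ) ∧
    -- each `c j` is a graded submodule (generated by homogeneous elements)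
    (∀ j, c j = Submodule.span (MvPolynomial (Fin n) K)
      ((c j : Set M) ∩ ⋃ a : Fin n → ℕ, (G.g a : Set M))) ∧
    (∀ i : Fin r, IsCM K n (subquotient (c i.castSucc) (c i.succ))) ∧
    (∀ i j : Fin r, i < j →
      mdim (MvPolynomial (Fin n) K) (subquotient (c i.castSucc) (c i.succ)) <
        mdim (MvPolynomial (Fin n) K) (subquotient (c j.castSucc) (c j.succ)))

open RingTheory.Sequence

section CommAlg
open scoped Pointwise

theorem quot_reg_iff {R L : Type} [CommRing R] [AddCommGroup L] [Module R L] (f g : R) :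
    IsSMulRegular (QuotSMulTop f L) g ↔ ∀ x y : L, g • x = f • y → ∃ z, x = f • z := by
  rw [isSMulRegular_quotient_iff_mem_of_smul_mem]
  simp only [Submodule.mem_smul_pointwise_iff_exists]
  constructor
  · intro h x y hxy
    obtain ⟨z, -, hz⟩ := h x ⟨y, trivial, hxy.symm⟩
    exact ⟨z, hz.symm⟩
  · rintro h x ⟨y, -, hy⟩
    obtain ⟨z, hz⟩ := h x y hy.symm
    exact ⟨z, trivial, hz.symm⟩

theorem reg_iff {R L : Type} [CommRing R] [AddCommGroup L] [Module R L] (f : R) :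
    IsSMulRegular L f ↔ ∀ x : L, f • x = 0 → x = 0 :=
  isSMulRegular_iff_right_eq_zero_of_smul

theorem reg_swap {R L : Type} [CommRing R] [AddCommGroup L] [Module R L] {f h : R}
    (hf : IsSMulRegular L f) (_ : IsSMulRegular L h)
    (hfh : IsSMulRegular (QuotSMulTop f L) h) : IsSMulRegular (QuotSMulTop h L) f := by
  rw [quot_reg_iff] at hfh ⊢
  intro x y hxy
  obtain ⟨z, hz⟩ := hfh y x hxy.symm
  refine ⟨z, hf ?_⟩
  simp only
  rw [hxy, hz, smul_comm]

theorem quot_comm {R L : Type} [CommRing R] [AddCommGroup L] [Module R L] (f h : R) :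
    Nonempty (QuotSMulTop f (QuotSMulTop h L) ≃ₗ[R] QuotSMulTop h (QuotSMulTop f L)) := by
  let e1 := Submodule.quotOfListConsSMulTopEquivQuotSMulTopInner L h [f]
  let e2 := Submodule.quotOfListConsSMulTopEquivQuotSMulTopInner L f [h]
  have hf : (Ideal.ofList [f] • ⊤ : Submodule R (QuotSMulTop h L)) = f • ⊤ := by
    rw [Ideal.ofList_singleton, Submodule.ideal_span_singleton_smul]
  have hh : (Ideal.ofList [h] • ⊤ : Submodule R (QuotSMulTop f L)) = h • ⊤ := by
    rw [Ideal.ofList_singleton, Submodule.ideal_span_singleton_smul]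
  have hc : (Ideal.ofList [h, f] • ⊤ : Submodule R L) = Ideal.ofList [f, h] • ⊤ := by
    simp only [Ideal.ofList_cons, Ideal.ofList_nil, bot_le, sup_of_le_left]
    rw [sup_comm]
  exact ⟨(Submodule.quotEquivOfEq _ _ hf).symm.trans <| e1.symm.trans <|
    (Submodule.quotEquivOfEq _ _ hc).trans <| e2.trans <| Submodule.quotEquivOfEq _ _ hh⟩

/-- there is a weakly regular sequence of length `k` in `I`. -/
def DGE {R : Type} [CommRing R] (I : Ideal R) (k : ℕ) (L : Type) [AddCommGroup L] [Module R L] :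
    Prop :=
  ∃ rs : List R, rs.length = k ∧ (∀ r ∈ rs, r ∈ I) ∧ IsWeaklyRegular L rs

theorem DGE_zero {R : Type} [CommRing R] (I : Ideal R) (L : Type) [AddCommGroup L] [Module R L] :
    DGE I 0 L := ⟨[], rfl, by simp, by simp⟩

theorem DGE_succ {R : Type} [CommRing R] (I : Ideal R) (k : ℕ) (L : Type) [AddCommGroup L]
    [Module R L] : DGE I (k + 1) L ↔ ∃ f ∈ I, IsSMulRegular L f ∧ DGE I k (QuotSMulTop f L) := by
  constructor
  · rintro ⟨rs, hl, hI, hr⟩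
    match rs with
    | [] => simp at hl
    | f :: rs =>
      rw [isWeaklyRegular_cons_iff] at hr
      exact ⟨f, hI f (by simp), hr.1, rs, by simpa using hl, fun r h => hI r (by simp [h]), hr.2⟩
  · rintro ⟨f, hf, hr, rs, hl, hI, hw⟩
    refine ⟨f :: rs, by simp [hl], ?_, by rw [isWeaklyRegular_cons_iff]; exact ⟨hr, hw⟩⟩
    intro r h
    rcases List.mem_cons.1 h with rfl | h
    · exact hf
    · exact hI r h

theorem DGE_congr {R : Type} [CommRing R] {I : Ideal R} {k : ℕ} {L L' : Type} [AddCommGroup L]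
    [Module R L] [AddCommGroup L'] [Module R L'] (e : L ≃ₗ[R] L') (h : DGE I k L) : DGE I k L' := by
  obtain ⟨rs, h1, h2, h3⟩ := h
  exact ⟨rs, h1, h2, (e.isWeaklyRegular_congr rs).1 h3⟩

def NoSoc {R : Type} [CommRing R] (I : Ideal R) (L : Type) [AddCommGroup L] [Module R L] : Prop :=
  ∀ x : L, (∀ i ∈ I, i • x = 0) → x = 0

theorem NoSoc_of_reg {R : Type} [CommRing R] {I : Ideal R} {L : Type} [AddCommGroup L]
    [Module R L] {f : R} (hf : f ∈ I) (h : IsSMulRegular L f) : NoSoc I L := by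
  intro x hx
  exact (reg_iff f).1 h x (hx f hf)

theorem exists_reg {R A : Type} [CommRing R] [CommRing A] [IsNoetherianRing A] (φ : R →+* A)
    (J : Ideal R) {L : Type} [AddCommGroup L] [Module A L] [Module.Finite A L]
    (h : NoSoc (J.map φ) L) : ∃ g ∈ J, IsSMulRegular L (φ g) := by
  by_contra! hc
  have key : (J : Set R) ⊆ ⋃ P ∈ associatedPrimes A L, (Ideal.comap φ P : Set R) := by
    intro g hg
    have : φ g ∈ ⋃ P ∈ associatedPrimes A L, (P : Set A) := by
      rw [biUnion_associatedPrimes_eq_compl_regular]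
      exact hc g hg
    simpa using this
  rw [Ideal.subset_union_prime_finite (associatedPrimes.finite A L) ⊤ ⊤
    (fun P hP _ _ => by have := IsAssociatedPrime.isPrime hP; exact inferInstance)] at key
  obtain ⟨P, hP, hJ⟩ := key
  have hP' := hP
  rw [AssociatedPrimes.mem_iff, isAssociatedPrime_iff] at hP'
  obtain ⟨hpr, x, hx⟩ := hP'
  have h0 : x = 0 := by
    apply h
    intro i hi
    have : i ∈ P := Ideal.map_le_iff_le_comap.2 hJ hi
    rw [hx] at this
    simpa [Submodule.mem_colon_singleton] using this
  apply hpr.ne_top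
  rw [hx, h0]
  ext; simp [Submodule.mem_colon_singleton]

theorem reg_of_prod {R : Type} [CommRing R] {L L' : Type} [AddCommGroup L]
    [Module R L] [AddCommGroup L'] [Module R L'] {f : R} (h : IsSMulRegular (L × L') f) :
    IsSMulRegular L f ∧ IsSMulRegular L' f := by
  rw [reg_iff] at *
  rw [reg_iff]
  constructor
  · intro x hx
    have := h (x, 0) (by simp [hx])
    simpa using this
  · intro x hx
    have := h (0, x) (by simp [hx])
    simpa using this

theorem NoSoc_prod {R : Type} [CommRing R] {I : Ideal R} {L L' : Type} [AddCommGroup L]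
    [Module R L] [AddCommGroup L'] [Module R L'] (h : NoSoc I L) (h' : NoSoc I L') :
    NoSoc I (L × L') := by
  rintro ⟨x, y⟩ hx
  have h1 := h x (fun i hi => by have := hx i hi; simp at this; exact this.1)
  have h2 := h' y (fun i hi => by have := hx i hi; simp at this; exact this.2)
  simp [h1, h2]

theorem NoSoc_quot {R : Type} [CommRing R] {I : Ideal R} {L : Type} [AddCommGroup L]
    [Module R L] {f f' g : R} (hf : f ∈ I) (hf' : f' ∈ I) (hr : IsSMulRegular L f)
    (hr' : IsSMulRegular (QuotSMulTop f L) f') (hg : IsSMulRegular L g) :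
    NoSoc I (QuotSMulTop g L) := by
  intro x
  obtain ⟨m, rfl⟩ := Submodule.Quotient.mk_surjective _ x
  intro hx
  have hx' : ∀ i ∈ I, ∃ y, i • m = g • y := by
    intro i hi
    have := hx i hi
    rw [← Submodule.Quotient.mk_smul, Submodule.Quotient.mk_eq_zero,
      Submodule.mem_smul_pointwise_iff_exists] at this
    obtain ⟨y, -, hy⟩ := this
    exact ⟨y, hy.symm⟩
  obtain ⟨m', hm'⟩ := hx' f hf
  obtain ⟨y, hy⟩ := hx' f' hf'
  rw [quot_reg_iff] at hr'
  obtain ⟨z, hz⟩ := hr' m' y (hg (by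
    simp only
    rw [smul_comm, ← hm', smul_comm, hy, smul_comm]))
  rw [Submodule.Quotient.mk_eq_zero, Submodule.mem_smul_pointwise_iff_exists]
  refine ⟨z, trivial, hr ?_⟩
  simp only
  rw [hm', hz, smul_comm]

theorem DGE_exchange {R : Type} [CommRing R] [IsNoetherianRing R] {I : Ideal R} (k : ℕ) :
    ∀ {L : Type} [AddCommGroup L] [Module R L] [Module.Finite R L] {g : R} (_ : g ∈ I)
      (_ : IsSMulRegular L g) (_ : DGE I (k + 1) L), DGE I k (QuotSMulTop g L) := by
  induction k with
  | zero => intros; exact DGE_zero _ _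
  | succ k ih =>
    intro L _ _ _ g hgI hg hL
    obtain ⟨f, hfI, hf, hL1⟩ := (DGE_succ _ _ _).1 hL
    obtain ⟨f', hfI', hf', -⟩ := (DGE_succ _ _ _).1 hL1
    have n1 : NoSoc I L := NoSoc_of_reg hgI hg
    have n2 : NoSoc I (QuotSMulTop f L) := NoSoc_of_reg hfI' hf'
    have n3 : NoSoc I (QuotSMulTop g L) := NoSoc_quot hfI hfI' hf hf' hg
    obtain ⟨h, hhI, hh⟩ := exists_reg (RingHom.id R) I
      (L := L × QuotSMulTop f L × QuotSMulTop g L)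
      (by rw [Ideal.map_id]; exact NoSoc_prod n1 (NoSoc_prod n2 n3))
    simp only [RingHom.id_apply] at hh
    obtain ⟨h1, hh⟩ := reg_of_prod hh
    obtain ⟨h2, h3⟩ := reg_of_prod hh
    have a1 : DGE I k (QuotSMulTop h (QuotSMulTop f L)) := ih hhI h2 hL1
    have a2 : DGE I (k + 1) (QuotSMulTop h L) := by
      rw [DGE_succ]
      exact ⟨f, hfI, reg_swap hf h1 h2, DGE_congr (quot_comm _ _).some a1⟩
    have a3 : DGE I k (QuotSMulTop g (QuotSMulTop h L)) := ih hgI (reg_swap hg h1 h3) a2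
    rw [DGE_succ]
    exact ⟨h, hhI, h3, DGE_congr (quot_comm _ _).some a3⟩

theorem DGE_transfer {R A : Type} [CommRing R] [CommRing A] [IsNoetherianRing A] (φ : R →+* A)
    (J : Ideal R) (I : Ideal A) (h1 : J.map φ ≤ I) (h2 : I ≤ (J.map φ).radical) (k : ℕ) :
    ∀ {L : Type} [AddCommGroup L] [Module A L] [Module.Finite A L] (_ : DGE I k L),
      ∃ gs : List R, gs.length = k ∧ (∀ r ∈ gs, r ∈ J) ∧ IsWeaklyRegular L (gs.map φ) := by
  induction k with
  | zero => intros; exact ⟨[], by simp⟩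
  | succ k ih =>
    intro L _ _ _ hL
    obtain ⟨f, hfI, hf, hL1⟩ := (DGE_succ _ _ _).1 hL
    obtain ⟨m, hm⟩ := h2 hfI
    obtain ⟨g, hgJ, hg⟩ := exists_reg φ J (NoSoc_of_reg hm (hf.pow m))
    obtain ⟨gs, b1, b2, b3⟩ := ih (DGE_exchange k (h1 (Ideal.mem_map_of_mem φ hgJ)) hg hL)
    refine ⟨g :: gs, by simp [b1], ?_, ?_⟩
    · intro r h
      rcases List.mem_cons.1 h with rfl | h
      · exact hgJ
      · exact b2 r h
    · rw [List.map_cons, isWeaklyRegular_cons_iff]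
      exact ⟨hg, b3⟩

theorem retract_lin {R : Type} [CommRing R] (gs : List R) :
    ∀ {Q L : Type} [AddCommGroup L] [Module R L] [AddCommGroup Q] [Module R Q]
      (ψ : Q →ₗ[R] L) (π : L →ₗ[R] Q) (_ : π ∘ₗ ψ = LinearMap.id) (_ : IsWeaklyRegular L gs),
      IsWeaklyRegular Q gs := by
  induction gs with
  | nil => intros; simp
  | cons g gs ih =>
    intro Q L _ _ _ _ ψ π h hL
    rw [isWeaklyRegular_cons_iff] at hL ⊢
    refine ⟨?_, ih (QuotSMulTop.map g ψ) (QuotSMulTop.map g π) ?_ hL.2⟩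
    · exact hL.1.of_injective ψ (fun x y hxy => by
        have := congrArg π hxy
        simpa [← LinearMap.comp_apply, h] using this)
    · rw [← QuotSMulTop.map_comp, h, QuotSMulTop.map_id]

theorem retract_main {R A : Type} [CommRing R] [CommRing A] (φ : R →+* A) (gs : List R)
    {Q L : Type} [AddCommGroup L] [Module A L] [AddCommGroup Q] [Module R Q]
    (ψ : Q →+ L) (π : L →+ Q) (hψ : ∀ r q, ψ (r • q) = φ r • ψ q)
    (hπ : ∀ r l, π (φ r • l) = r • π l) (h : ∀ q, π (ψ q) = q)
    (hL : IsWeaklyRegular L (gs.map φ)) : IsWeaklyRegular Q gs := by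
  let := φ.toAlgebra
  let := Module.compHom L φ
  have : IsScalarTower R A L := ⟨fun r a l => by
    change (φ r * a) • l = φ r • (a • l)
    rw [mul_smul]⟩
  have hL' := (isWeaklyRegular_map_algebraMap_iff (R := R) (S := A) L gs).1 hL
  refine retract_lin gs (L := L) { ψ with map_smul' := hψ } { π with map_smul' := hπ } ?_ hL'
  ext q
  exact h q

theorem retract_finite {R A : Type} [CommRing R] [CommRing A] (φ : R →+* A) (hφ : φ.Finite)
    {Q L : Type} [AddCommGroup L] [Module A L] [AddCommGroup Q] [Module R Q] [Module.Finite A L]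
    (π : L →+ Q) (hπ : ∀ r l, π (φ r • l) = r • π l) (h : Function.Surjective π) :
    Module.Finite R Q := by
  let := φ.toAlgebra
  let := Module.compHom L φ
  have : IsScalarTower R A L := ⟨fun r a l => by
    change (φ r * a) • l = φ r • (a • l)
    rw [mul_smul]⟩
  have : Module.Finite R A := hφ
  have : Module.Finite R L := Module.Finite.trans A L
  exact Module.Finite.of_surjective ({ π with map_smul' := hπ } : L →ₗ[R] Q) h

theorem dim_comap_le {R A : Type} [CommRing R] [CommRing A] (φ : R →+* A) (hφ : φ.IsIntegral)
    (I : Ideal A) : ringKrullDim (R ⧸ I.comap φ) ≤ ringKrullDim (A ⧸ I) := by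
  let := φ.toAlgebra
  have : Algebra.IsIntegral R A := ⟨hφ⟩
  change ringKrullDim (R ⧸ I.comap (algebraMap R A)) ≤ _
  let : Algebra (R ⧸ I.comap (algebraMap R A)) (A ⧸ I) := Ideal.quotientAlgebra
  have : Algebra.IsIntegral (R ⧸ I.comap (algebraMap R A)) (A ⧸ I) := inferInstance
  have : Algebra.HasGoingUp (R ⧸ I.comap (algebraMap R A)) (A ⧸ I) := inferInstance
  refine iSup_le fun l => ?_
  obtain ⟨P, -, hP, hP'⟩ := Ideal.exists_ideal_over_prime_of_isIntegral
    (R := (R ⧸ I.comap (algebraMap R A))) (S := A ⧸ I) (l.head).asIdeal ⊥ (by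
      have : Function.Injective (algebraMap (R ⧸ I.comap (algebraMap R A)) (A ⧸ I)) :=
        Ideal.algebraMap_quotient_injective
      rw [← RingHom.ker, (RingHom.injective_iff_ker_eq_bot _).1 this]
      exact bot_le)
  have : P.LiesOver l.head.asIdeal := ⟨hP'.symm⟩
  obtain ⟨l', h1, -⟩ := Ideal.exists_ltSeries_of_hasGoingUp l P
  rw [← h1]
  exact Order.LTSeries.length_le_krullDim l'

theorem ass_step {R : Type} [CommRing R] [IsNoetherianRing R] {m : Ideal R} [m.IsPrime]
    {L : Type} [AddCommGroup L] [Module R L] [Module.Finite R L] {f : R} (hf : f ∈ m)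
    (hr : IsSMulRegular L f) {P : Ideal R} (hP : P ∈ associatedPrimes R L) (hPm : P ≤ m) :
    ∃ Q ∈ associatedPrimes R (QuotSMulTop f L), P < Q ∧ Q ≤ m := by
  rw [AssociatedPrimes.mem_iff, isAssociatedPrime_iff] at hP
  obtain ⟨hpr, z, hz⟩ := hP
  have hz' : ∀ r, r ∈ P ↔ r • z = 0 := by
    intro r; rw [hz]; simp [Submodule.mem_colon_singleton]
  let N0 : Submodule R L := 
    { carrier := {x | ∀ p ∈ P, p • x = 0}
      add_mem' := fun {x y} hx hy p hp => by rw [smul_add, hx p hp, hy p hp, add_zero]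
      zero_mem' := fun p hp => smul_zero p
      smul_mem' := fun r x hx p hp => by rw [smul_comm, hx p hp, smul_zero] }
  have hzN : z ∈ N0 := fun p hp => (hz' p).1 hp
  let T : Submodule R (QuotSMulTop f L) := N0.map (Submodule.mkQ _)
  have hfP : f ∉ P := by
    intro h
    have h0 := (reg_iff f).1 hr z ((hz' f).1 h)
    apply hpr.ne_top
    rw [Ideal.eq_top_iff_one, hz', h0, smul_zero]
  have hT : Module.annihilator R T ≤ m := by
    intro s hs
    rw [Module.mem_annihilator] at hs
    have hs' : ∀ x ∈ N0, ∃ y ∈ N0, s • x = f • y := by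
      intro x hx
      have := hs ⟨Submodule.mkQ _ x, Submodule.mem_map_of_mem hx⟩
      rw [Subtype.ext_iff] at this
      simp only [Submodule.coe_smul, Submodule.coe_zero] at this
      rw [← map_smul, Submodule.mkQ_apply, Submodule.Quotient.mk_eq_zero,
        Submodule.mem_smul_pointwise_iff_exists] at this
      obtain ⟨y, -, hy⟩ := this
      refine ⟨y, ?_, hy.symm⟩
      intro p hp
      apply (reg_iff f).1 hr
      rw [smul_comm, hy, smul_comm, hx p hp, smul_zero]
    obtain ⟨q, hq1, -, hq2, hq3⟩ :=
      LinearMap.exists_monic_and_natDegree_eq_and_coeff_mem_pow_and_aeval_eq_zero R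
        (LinearMap.lsmul R N0 s) (Ideal.span {f}) (by
          rintro _ ⟨⟨x, hx⟩, rfl⟩
          obtain ⟨y, hy, hxy⟩ := hs' x hx
          have : (LinearMap.lsmul R N0 s) ⟨x, hx⟩ = f • (⟨y, hy⟩ : N0) := by
            ext; simpa using hxy
          rw [this]
          exact Submodule.smul_mem_smul (Ideal.mem_span_singleton_self f) trivial)
    have h4 : q.eval s ∈ P := by
      rw [hz']
      have := congrArg (fun g => ((g ⟨z, hzN⟩ : N0) : L)) hq3
      have h5 : (LinearMap.lsmul R N0 s) = algebraMap R (Module.End R N0) s := by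
        ext; simp
      simp only [h5, Polynomial.aeval_algebraMap_apply] at this
      simpa using this
    have h6 := hPm h4
    rw [Polynomial.eval_eq_sum_range, Finset.sum_range_succ, hq1.coeff_natDegree, one_mul] at h6
    have h7 : ∑ x ∈ Finset.range q.natDegree, q.coeff x * s ^ x ∈ m := by
      refine Ideal.sum_mem _ fun i hi => Ideal.mul_mem_right _ _ ?_
      have h8 := hq2 i
      have h9 : q.natDegree - i ≠ 0 := by have := Finset.mem_range.1 hi; omega
      have h10 := Ideal.pow_le_self h9 h8
      exact (Ideal.span_singleton_le_iff_mem _).2 hf h10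
    exact Ideal.IsPrime.mem_of_pow_mem inferInstance _ ((Ideal.add_mem_iff_right _ h7).1 h6)
  obtain ⟨Q, hQ, hQm⟩ := Ideal.exists_minimalPrimes_le hT
  refine ⟨Q, ?_, ?_, hQm⟩
  · exact associatedPrimes.subset_of_injective (f := T.subtype) T.subtype_injective
      (Module.associatedPrimes.minimalPrimes_annihilator_subset_associatedPrimes R T hQ)
  · have hPQ : P ≤ Q := by
      refine le_trans ?_ hQ.1.2
      intro p hp
      rw [Module.mem_annihilator]
      rintro ⟨_, x, hx, rfl⟩
      ext
      simp only [Submodule.coe_smul, Submodule.coe_zero]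
      rw [← map_smul, hx p hp, map_zero]
    refine lt_of_le_of_ne hPQ ?_
    rintro rfl
    apply hfP
    apply hQ.1.2
    rw [Module.mem_annihilator]
    rintro ⟨_, x, hx, rfl⟩
    ext
    simp only [Submodule.coe_smul, Submodule.coe_zero]
    rw [← map_smul, Submodule.mkQ_apply, Submodule.Quotient.mk_eq_zero]
    exact Submodule.smul_mem_pointwise_smul _ _ _ trivial

theorem ass_coheight {R : Type} [CommRing R] [IsNoetherianRing R] {m : Ideal R} [m.IsPrime]
    (k : ℕ) :
    ∀ {L : Type} [AddCommGroup L] [Module R L] [Module.Finite R L] (_ : DGE m k L)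
      {P : Ideal R} (hP : P ∈ associatedPrimes R L) (_ : P ≤ m),
      (k : ℕ∞) ≤ Order.coheight (⟨P, IsAssociatedPrime.isPrime hP⟩ : PrimeSpectrum R) := by
  induction k with
  | zero => intros; simp
  | succ k ih =>
    intro L _ _ _ hL P hP hPm
    obtain ⟨f, hfI, hf, hL1⟩ := (DGE_succ _ _ _).1 hL
    obtain ⟨Q, hQ, hPQ, hQm⟩ := ass_step hfI hf hP hPm
    refine le_trans ?_ (Order.coheight_add_one_le
      (show (⟨P, IsAssociatedPrime.isPrime hP⟩ : PrimeSpectrum R) <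
        ⟨Q, IsAssociatedPrime.isPrime hQ⟩ from hPQ))
    push_cast
    gcongr
    exact ih hL1 hQ hQm

theorem depth_le_dim {R : Type} [CommRing R] [IsNoetherianRing R] {m : Ideal R} [m.IsPrime]
    {k : ℕ} {L : Type} [AddCommGroup L] [Module R L] [Module.Finite R L] [Nontrivial L]
    (hgood : ∀ (f : R) (z : L), f ∉ m → f • z = 0 → z = 0) (h : DGE m k L) :
    (k : WithBot ℕ∞) ≤ ringKrullDim (R ⧸ (⊤ : Submodule R L).annihilator) := by
  obtain ⟨P, hP⟩ := associatedPrimes.nonempty R L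
  have hP' := hP
  rw [AssociatedPrimes.mem_iff, isAssociatedPrime_iff] at hP'
  obtain ⟨hpr, z, hz⟩ := hP'
  have hz' : ∀ r, r ∈ P ↔ r • z = 0 := by
    intro r; rw [hz]; simp [Submodule.mem_colon_singleton]
  have hz0 : z ≠ 0 := by
    rintro rfl
    apply hpr.ne_top
    rw [Ideal.eq_top_iff_one, hz', smul_zero]
  have hPm : P ≤ m := by
    intro r hr
    by_contra hrm
    exact hz0 (hgood r z hrm ((hz' r).1 hr))
  have h1 := ass_coheight k h hP hPm
  have hle : (⊤ : Submodule R L).annihilator ≤ P := by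
    intro r hr
    rw [hz']
    exact Submodule.mem_annihilator.1 hr z trivial
  rw [ringKrullDim_quotient]
  have h2 := Order.coheight_eq_krullDim_Ici (⟨P, hpr⟩ : PrimeSpectrum R)
  have h3 : ((k : ℕ∞) : WithBot ℕ∞) ≤ Order.krullDim (Set.Ici (⟨P, hpr⟩ : PrimeSpectrum R)) := by
    rw [← h2]
    exact_mod_cast h1
  refine le_trans (by exact_mod_cast h3) (Order.krullDim_le_of_strictMono
    (fun x : Set.Ici (⟨P, hpr⟩ : PrimeSpectrum R) => ⟨x.1, ?_⟩) ?_)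
  · rw [PrimeSpectrum.mem_zeroLocus]
    exact le_trans (SetLike.coe_subset_coe.2 hle) x.2
  · intro x y hxy
    exact hxy

theorem regular_of_weak {R : Type} [CommRing R] [IsNoetherianRing R] {m : Ideal R} [m.IsPrime]
    {L : Type} [AddCommGroup L] [Module R L] [Module.Finite R L] [Nontrivial L]
    (hgood : ∀ (f : R) (z : L), f ∉ m → f • z = 0 → z = 0) {rs : List R} (hm : ∀ r ∈ rs, r ∈ m)
    (h : IsWeaklyRegular L rs) : IsRegular L rs := by
  refine ⟨h, ?_⟩
  intro htop
  obtain ⟨r, hr1, hr2⟩ := Submodule.exists_sub_one_mem_and_smul_eq_zero_of_fg_of_le_smul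
    (Ideal.ofList rs) (⊤ : Submodule R L) Module.Finite.fg_top htop.le
  have hle : Ideal.ofList rs ≤ m := Ideal.span_le.2 hm
  obtain ⟨z, hz⟩ := exists_ne (0 : L)
  refine hz (hgood r z ?_ (hr2 z trivial))
  intro hrm
  apply (inferInstance : m.IsPrime).ne_top
  rw [Ideal.eq_top_iff_one]
  have := Ideal.sub_mem _ hrm (hle hr1)
  simpa using this

end CommAlg

section Grad

theorem mono_zero' : mono K (0 : Fin n → ℕ) = 1 := by
  have h : (Finsupp.equivFunOnFinite.symm (0 : Fin n → ℕ)) = 0 := by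
    ext i
    simp
  rw [mono, h]
  simp

theorem mono_add' (a b : Fin n → ℕ) : mono K (a + b) = mono K a * mono K b := by
  unfold mono
  rw [monomial_mul, one_mul]
  have h : Finsupp.equivFunOnFinite.symm (a + b) =
      Finsupp.equivFunOnFinite.symm a + Finsupp.equivFunOnFinite.symm b := by
    ext i
    simp
  rw [h]

theorem mono_single (i : Fin n) : mono K (Pi.single i 1) = X i := by
  unfold mono X
  congr 1
  ext j
  simp [Finsupp.single_apply, Pi.single_apply, eq_comm]

theorem monomial_eq_smul_mono (u : Fin n →₀ ℕ) (c : K) :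
    monomial u c = c • mono K (u : Fin n → ℕ) := by
  unfold mono
  rw [smul_monomial]
  simp

variable {M : Type} [AddCommGroup M] [Module (MvPolynomial (Fin n) K) M]
    [Module K M] [IsScalarTower K (MvPolynomial (Fin n) K) M]

theorem MultiGrading.exists_lift (G : MultiGrading K n M) {W : Type} [AddCommGroup W] [Module K W]
    (f : (a : Fin n → ℕ) → (G.g a →ₗ[K] W)) :
    ∃ F : M →ₗ[K] W, ∀ a (m : G.g a), F m = f a m := by
  let e : (DirectSum (Fin n → ℕ) fun a => G.g a) ≃ₗ[K] M :=
    LinearEquiv.ofBijective (DirectSum.coeLinearMap G.g) G.internal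
  refine ⟨DirectSum.toModule K _ W f ∘ₗ e.symm.toLinearMap, fun a m => ?_⟩
  have : e.symm m = DirectSum.lof K _ (fun a => G.g a) a m := by
    rw [LinearEquiv.symm_apply_eq]
    exact (DirectSum.coeLinearMap_lof G.g a m).symm
  simp [this]

theorem MultiGrading.exists_p (G : MultiGrading K n M) (a : Fin n → ℕ) :
    ∃ F : M →ₗ[K] M, ∀ b (m : G.g b), F m = if b = a then (m : M) else 0 := by
  obtain ⟨F, hF⟩ := G.exists_lift (fun b => if b = a then (G.g b).subtype else 0)
  refine ⟨F, fun b m => ?_⟩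
  rw [hF]
  split_ifs <;> simp

noncomputable def MultiGrading.p (G : MultiGrading K n M) (a : Fin n → ℕ) : M →ₗ[K] M :=
  (G.exists_p a).choose

theorem MultiGrading.p_hom (G : MultiGrading K n M) (a : Fin n → ℕ) {b : Fin n → ℕ} {m : M}
    (hm : m ∈ G.g b) : G.p a m = if b = a then m else 0 :=
  (G.exists_p a).choose_spec b ⟨m, hm⟩

theorem MultiGrading.ind (G : MultiGrading K n M) {P : M → Prop} (h0 : P 0)
    (hadd : ∀ x y, P x → P y → P (x + y)) (hh : ∀ a, ∀ m ∈ G.g a, P m) (z : M) : P z := by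
  obtain ⟨x, rfl⟩ := G.internal.2 z
  induction x using DirectSum.induction_on with
  | zero => simpa using h0
  | of i x => simpa using hh i x x.2
  | add x y hx hy => rw [map_add]; exact hadd _ _ hx hy

theorem MultiGrading.p_mem (G : MultiGrading K n M) (a : Fin n → ℕ) (z : M) : G.p a z ∈ G.g a := by
  refine G.ind (P := fun z => G.p a z ∈ G.g a) (by simp) ?_ ?_ z
  · intro x y hx hy; rw [map_add]; exact add_mem hx hy
  · intro b m hm
    rw [G.p_hom a hm]
    split_ifs with h
    · exact h ▸ hm
    · exact zero_mem _

theorem MultiGrading.exists_sum (G : MultiGrading K n M) (z : M) :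
    ∃ s : Finset (Fin n → ℕ), ∀ s', s ⊆ s' → z = ∑ a ∈ s', G.p a z := by
  classical
  refine G.ind (P := fun z => ∃ s : Finset (Fin n → ℕ), ∀ s', s ⊆ s' → z = ∑ a ∈ s', G.p a z)
    ⟨∅, by simp⟩ ?_ ?_ z
  · rintro x y ⟨s, hs⟩ ⟨s', hs'⟩
    refine ⟨s ∪ s', fun u hu => ?_⟩
    simp only [map_add, Finset.sum_add_distrib]
    rw [← hs u (Finset.union_subset_left hu), ← hs' u (Finset.union_subset_right hu)]
  · intro a m hm
    refine ⟨{a}, fun u hu => ?_⟩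
    have : a ∈ u := hu (by simp)
    simp [G.p_hom _ hm, this]

theorem MultiGrading.mem_of_p (G : MultiGrading K n M) {T : Type} [SetLike T M]
    [AddSubmonoidClass T M] (c : T) (z : M) (h : ∀ a, G.p a z ∈ c) : z ∈ c := by
  obtain ⟨s, hs⟩ := G.exists_sum z
  rw [hs s subset_rfl]
  exact sum_mem fun a _ => h a

theorem MultiGrading.p_mono (G : MultiGrading K n M) (a b : Fin n → ℕ) (z : M) :
    G.p (a + b) (mono K b • z) = mono K b • G.p a z := by
  refine G.ind (P := fun z => G.p (a + b) (mono K b • z) = mono K b • G.p a z) (by simp) ?_ ?_ z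
  · intro x y hx hy; simp only [smul_add, map_add, hx, hy]
  · intro d m hm
    rw [G.p_hom _ hm, G.p_hom _ (G.compat d b m hm)]
    simp only [add_left_inj]
    split_ifs <;> simp

theorem MultiGrading.p_mono_not (G : MultiGrading K n M) (a b : Fin n → ℕ) (h : ¬ b ≤ a) (z : M) :
    G.p a (mono K b • z) = 0 := by
  refine G.ind (P := fun z => G.p a (mono K b • z) = 0) (by simp) ?_ ?_ z
  · intro x y hx hy; simp only [smul_add, map_add, hx, hy, add_zero]
  · intro d m hm
    rw [G.p_hom _ (G.compat d b m hm), if_neg]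
    rintro rfl
    exact h (by intro i; simp)

def IsGr (G : MultiGrading K n M) (c : Submodule (MvPolynomial (Fin n) K) M) : Prop :=
  ∀ z ∈ c, ∀ a, G.p a z ∈ c

theorem smul_mem_K (c : Submodule (MvPolynomial (Fin n) K) M) (k : K) {z : M} (hz : z ∈ c) :
    k • z ∈ c := by
  rw [← IsScalarTower.algebraMap_smul (MvPolynomial (Fin n) K) k z]
  exact c.smul_mem _ hz

theorem IsGr_iff (G : MultiGrading K n M) (c : Submodule (MvPolynomial (Fin n) K) M) :
    (c = Submodule.span (MvPolynomial (Fin n) K)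
      ((c : Set M) ∩ ⋃ a : Fin n → ℕ, (G.g a : Set M))) ↔ IsGr G c := by
  constructor
  · intro h z hz
    rw [h] at hz
    induction hz using Submodule.span_induction with
    | zero => intro a; simp
    | add x y _ _ hx hy => intro a; rw [map_add]; exact add_mem (hx a) (hy a)
    | mem x hx =>
      intro a
      obtain ⟨hx, hx'⟩ := hx
      simp only [Set.mem_iUnion] at hx'
      obtain ⟨b, hb⟩ := hx'
      rw [G.p_hom _ hb]
      split_ifs
      · exact hx
      · simp
    | smul s x _ hx =>
      induction s using MvPolynomial.induction_on' with
      | add p q hp hq => intro a; rw [add_smul, map_add]; exact add_mem (hp a) (hq a)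
      | monomial u k =>
        intro a
        rw [monomial_eq_smul_mono, smul_assoc, map_smul]
        apply smul_mem_K
        by_cases hle : (u : Fin n → ℕ) ≤ a
        · obtain ⟨d, rfl⟩ := exists_add_of_le hle
          rw [add_comm, G.p_mono]
          exact c.smul_mem _ (hx d)
        · rw [G.p_mono_not _ _ hle]
          simp
  · intro h
    apply le_antisymm
    · intro z hz
      refine G.mem_of_p _ z fun a => Submodule.subset_span ⟨h z hz a, ?_⟩
      exact Set.mem_iUnion.2 ⟨a, G.p_mem a z⟩
    · rw [Submodule.span_le]
      exact Set.inter_subset_left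

noncomputable abbrev mm (K : Type) [Field K] (n : ℕ) : Ideal (MvPolynomial (Fin n) K) :=
  Ideal.span (Set.range (X : Fin n → MvPolynomial (Fin n) K))

theorem mm_eq : mm K n = RingHom.ker (constantCoeff : MvPolynomial (Fin n) K →+* K) := by
  ext f
  rw [mm, ← Set.image_univ, mem_ideal_span_X_image, RingHom.mem_ker, constantCoeff_eq]
  constructor
  · intro h
    by_contra h0
    obtain ⟨i, -, hi⟩ := h 0 (mem_support_iff.2 h0)
    simp at hi
  · intro h u hu
    by_contra! hc
    have : u = 0 := by ext i; simpa using hc i trivial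
    rw [mem_support_iff, this] at hu
    exact hu h

instance mm_prime : (mm K n).IsPrime := by
  rw [mm_eq]; exact RingHom.ker_isPrime _

theorem gr_good (G : MultiGrading K n M) (c : Submodule (MvPolynomial (Fin n) K) M)
    (hc : IsGr G c) (f : MvPolynomial (Fin n) K) (z : M) (hf : f ∉ mm K n) (hz : f • z ∈ c) :
    z ∈ c := by
  have hf0 : coeff 0 f ≠ 0 := by
    rwa [mm_eq, RingHom.mem_ker, constantCoeff_eq] at hf
  have key : ∀ d : ℕ, ∀ a : Fin n → ℕ, ∑ i, a i = d → G.p a z ∈ c := by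
    intro d
    induction d using Nat.strong_induction_on with
    | _ d ih =>
    intro a ha
    have h1 := hc _ hz a
    have h2 : f • z = ∑ u ∈ f.support, coeff u f • (mono K (u : Fin n → ℕ) • z) := by
      conv_lhs => rw [f.as_sum, Finset.sum_smul]
      refine Finset.sum_congr rfl fun u _ => ?_
      rw [monomial_eq_smul_mono, smul_assoc]
    rw [h2, map_sum, ← Finset.add_sum_erase _ _ (mem_support_iff.2 hf0)] at h1
    have h3 : ∑ u ∈ f.support.erase 0, G.p a (coeff u f • (mono K (u : Fin n → ℕ) • z)) ∈ c := by
      refine sum_mem fun u hu => ?_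
      rw [map_smul]
      apply smul_mem_K
      by_cases hle : (u : Fin n → ℕ) ≤ a
      · obtain ⟨b, rfl⟩ := exists_add_of_le hle
        rw [add_comm, G.p_mono]
        refine c.smul_mem _ (ih (∑ i, b i) ?_ b rfl)
        rw [← ha]
        simp only [Pi.add_apply, Finset.sum_add_distrib]
        have hu0 : u ≠ 0 := (Finset.mem_erase.1 hu).1
        obtain ⟨i, hi⟩ := Finsupp.ne_iff.1 hu0
        have : u i ≤ ∑ i, u i := Finset.single_le_sum (fun _ _ => Nat.zero_le _) (Finset.mem_univ i)
        simp at hi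
        omega
      · rw [G.p_mono_not _ _ hle]
        simp
    have h4 := (Submodule.add_mem_iff_left _ h3).1 h1
    rw [Finsupp.coe_zero, mono_zero', one_smul, map_smul] at h4
    have h5 := smul_mem_K c (coeff 0 f)⁻¹ h4
    rwa [smul_smul, inv_mul_cancel₀ hf0, one_smul] at h5
  exact G.mem_of_p _ z fun a => key _ a rfl

theorem posdet_iter (G : MultiGrading K n M) (t : Fin n → ℕ) (hM : PosDetermined G t) :
    ∀ (d : ℕ) (a c : Fin n → ℕ), ∑ i, c i = d → (∀ i, 0 < c i → t i ≤ a i) →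
      Set.BijOn (fun m => mono K c • m) (G.g a : Set M) (G.g (a + c) : Set M) := by
  intro d
  induction d with
  | zero =>
    intro a c hc _
    have : c = 0 := by
      ext i
      simpa using (Finset.sum_eq_zero_iff.1 hc) i (Finset.mem_univ i)
    subst this
    rw [add_zero, mono_zero']
    simp only [one_smul]
    exact Set.bijOn_id _
  | succ d ih =>
    intro a c hc h
    have : ∃ i, 0 < c i := by
      by_contra! h0
      have : ∑ i, c i = 0 := Finset.sum_eq_zero fun i _ => by have := h0 i; omega
      omega
    obtain ⟨i, hi⟩ := this
    let c' : Fin n → ℕ := c - Pi.single i 1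
    have hcc : c = c' + Pi.single i 1 := by
      ext j
      by_cases hj : j = i
      · subst hj; simp [c']; omega
      · simp [c', hj]
    have h1 : ∑ i, c' i = d := by
      rw [hcc] at hc
      simp only [Pi.add_apply, Finset.sum_add_distrib, Finset.sum_pi_single', Finset.mem_univ,
        if_true] at hc
      omega
    have h2 := ih a c' h1 (fun j hj => h j (lt_of_lt_of_le hj (by simp [c'])))
    have h3 := hM (a + c') i (le_trans (h i hi) (by simp))
    have h4 := h3.comp h2
    rw [hcc, ← add_assoc, mono_add', mul_comm, mono_single]
    convert h4 using 1
    ext m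
    simp [mul_smul]

theorem rmap_le (t : Fin n → ℕ) (a : Fin n → ℕ) : rmap t a ≤ t * a := by
  intro i
  simp only [rmap, Pi.mul_apply]
  split_ifs with h
  · exact Nat.le_mul_of_pos_right _ h
  · simp

theorem rmap_mono (t : Fin n → ℕ) (a b : Fin n → ℕ) : rmap t a ≤ rmap t (a + b) := by
  intro i
  simp only [rmap, Pi.add_apply]
  split_ifs <;> first | omega | simp

noncomputable def phi (K : Type) [Field K] {n : ℕ} (t : Fin n → ℕ) :
    MvPolynomial (Fin n) K →ₐ[K] MvPolynomial (Fin n) K := aeval (fun i => X i ^ t i)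

theorem phi_mono (t b : Fin n → ℕ) : phi K t (mono K b) = mono K (t * b) := by
  unfold phi mono
  rw [aeval_monomial, map_one, one_mul, monomial_eq, map_one, one_mul,
    Finsupp.prod_fintype _ _ (by simp), Finsupp.prod_fintype _ _ (by simp)]
  refine Finset.prod_congr rfl fun i _ => ?_
  simp [pow_mul]

theorem phi_integral (t : Fin n → ℕ) (ht : ∀ i, 1 ≤ t i) :
    (phi K t : MvPolynomial (Fin n) K →+* MvPolynomial (Fin n) K).IsIntegral := by
  intro x
  induction x using MvPolynomial.induction_on with
  | C a =>
    have := RingHom.isIntegralElem_map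
      (phi K t : MvPolynomial (Fin n) K →+* MvPolynomial (Fin n) K) (x := C a)
    simpa [phi] using this
  | add p q hp hq => exact hp.add _ hq
  | mul_X p i hp =>
    refine hp.mul _ ⟨Polynomial.X ^ t i - Polynomial.C (X i),
      Polynomial.monic_X_pow_sub_C _ (by have := ht i; omega), ?_⟩
    simp [phi]

theorem phi_finite (t : Fin n → ℕ) (ht : ∀ i, 1 ≤ t i) :
    (phi K t : MvPolynomial (Fin n) K →+* MvPolynomial (Fin n) K).Finite := by
  refine RingHom.IsIntegral.to_finite (phi_integral t ht) ?_
  apply RingHom.FiniteType.of_comp_finiteType (f := (C : K →+* MvPolynomial (Fin n) K))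
  have h1 : ((phi K t : MvPolynomial (Fin n) K →+* MvPolynomial (Fin n) K).comp C) =
      algebraMap K (MvPolynomial (Fin n) K) := by
    ext a; simp [phi]
  rw [h1, RingHom.finiteType_algebraMap]
  infer_instance

theorem phi_map_le (t : Fin n → ℕ) (ht : ∀ i, 1 ≤ t i) :
    (mm K n).map (phi K t : MvPolynomial (Fin n) K →+* MvPolynomial (Fin n) K) ≤ mm K n := by
  rw [Ideal.map_span, Ideal.span_le]
  rintro _ ⟨_, ⟨i, rfl⟩, rfl⟩
  have : (phi K t : MvPolynomial (Fin n) K →+* MvPolynomial (Fin n) K) (X i) = X i ^ t i := by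
    simp [phi]
  rw [this]
  have hX : (X i : MvPolynomial (Fin n) K) ∈ mm K n := Ideal.subset_span (Set.mem_range_self i)
  exact Ideal.pow_mem_of_mem _ hX _ (by have := ht i; omega)

theorem phi_le_rad (t : Fin n → ℕ) : mm K n ≤
    ((mm K n).map (phi K t : MvPolynomial (Fin n) K →+* MvPolynomial (Fin n) K)).radical := by
  rw [mm, Ideal.span_le]
  rintro _ ⟨i, rfl⟩
  have : (phi K t : MvPolynomial (Fin n) K →+* MvPolynomial (Fin n) K) (X i) = X i ^ t i := by
    simp [phi]
  refine ⟨t i, ?_⟩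
  rw [← this]
  exact Ideal.mem_map_of_mem _ (Ideal.subset_span ⟨i, rfl⟩)

end Grad

section RStar

open RingTheory.Sequence

theorem cm_retract (t : Fin n → ℕ) (ht : ∀ i, 1 ≤ t i) {Q L : Type}
    [AddCommGroup L] [Module (MvPolynomial (Fin n) K) L]
    [AddCommGroup Q] [Module (MvPolynomial (Fin n) K) Q]
    [Module.Finite (MvPolynomial (Fin n) K) L] [Nontrivial Q]
    (gL : ∀ (f : MvPolynomial (Fin n) K) (z : L), f ∉ mm K n → f • z = 0 → z = 0)
    (gQ : ∀ (f : MvPolynomial (Fin n) K) (z : Q), f ∉ mm K n → f • z = 0 → z = 0)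
    (ψ : Q →+ L) (π : L →+ Q) (hψ : ∀ r q, ψ (r • q) = phi K t r • ψ q)
    (hπ : ∀ r l, π (phi K t r • l) = r • π l) (h : ∀ q, π (ψ q) = q)
    (hL : IsCM K n L) :
    IsCM K n Q ∧ mdim (MvPolynomial (Fin n) K) Q = mdim (MvPolynomial (Fin n) K) L := by
  have hinj : Function.Injective ψ := Function.LeftInverse.injective h
  have : Nontrivial L := hinj.nontrivial
  have hfin : Module.Finite (MvPolynomial (Fin n) K) Q :=
    retract_finite (phi K t : MvPolynomial (Fin n) K →+* MvPolynomial (Fin n) K)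
      (phi_finite t ht) π hπ (Function.RightInverse.surjective h)
  unfold IsCM at hL
  set d := mdepth K n L with hd
  -- depth of L is attained
  have hdL : DGE (mm K n) d L := by
    have hmem : d ∈ {k : ℕ | ∃ rs : List (MvPolynomial (Fin n) K), rs.length = k ∧
        (∀ r ∈ rs, r ∈ Ideal.span (Set.range (X : Fin n → MvPolynomial (Fin n) K))) ∧
        RingTheory.Sequence.IsRegular L rs} := by
      apply Nat.sSup_mem
      · exact ⟨0, [], rfl, by simp, regular_of_weak gL (by simp) (by simp)⟩
      · refine ⟨d, ?_⟩
        rintro k ⟨rs, h1, h2, h3⟩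
        have := depth_le_dim (k := k) gL ⟨rs, h1, h2, h3.toIsWeaklyRegular⟩
        change _ ≤ mdim _ L at this
        rw [← hL] at this
        exact_mod_cast this
    obtain ⟨rs, h1, h2, h3⟩ := hmem
    exact ⟨rs, h1, h2, h3.toIsWeaklyRegular⟩
  obtain ⟨gs, h1, h2, h3⟩ := DGE_transfer
    (phi K t : MvPolynomial (Fin n) K →+* MvPolynomial (Fin n) K) (mm K n) (mm K n)
    (phi_map_le t ht) (phi_le_rad t) d hdL
  have h4 := retract_main (phi K t : MvPolynomial (Fin n) K →+* MvPolynomial (Fin n) K) gs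
    ψ π hψ hπ h h3
  have h5 := regular_of_weak gQ h2 h4
  have hle : mdim (MvPolynomial (Fin n) K) Q ≤ mdim (MvPolynomial (Fin n) K) L := by
    have h6 : ((⊤ : Submodule (MvPolynomial (Fin n) K) L).annihilator).comap
        (phi K t : MvPolynomial (Fin n) K →+* MvPolynomial (Fin n) K) ≤
        (⊤ : Submodule (MvPolynomial (Fin n) K) Q).annihilator := by
      intro r hr
      rw [Ideal.mem_comap, Submodule.mem_annihilator] at hr
      rw [Submodule.mem_annihilator]
      intro q _
      apply hinj
      rw [hψ, map_zero]
      exact hr _ trivial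
    refine le_trans (ringKrullDim_le_of_surjective (Ideal.Quotient.factor h6)
      (Ideal.Quotient.factor_surjective h6)) (dim_comap_le _ (phi_integral t ht) _)
  have hge : (d : WithBot ℕ∞) ≤ mdim (MvPolynomial (Fin n) K) Q :=
    depth_le_dim gQ ⟨gs, h1, h2, h4⟩
  have heq : mdim (MvPolynomial (Fin n) K) Q = d := le_antisymm (hL ▸ hle) hge
  refine ⟨?_, heq.trans hL⟩
  unfold IsCM
  rw [heq]
  have : mdepth K n Q = d := by
    have hgr : IsGreatest {k : ℕ | ∃ rs : List (MvPolynomial (Fin n) K), rs.length = k ∧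
        (∀ r ∈ rs, r ∈ Ideal.span (Set.range (X : Fin n → MvPolynomial (Fin n) K))) ∧
        RingTheory.Sequence.IsRegular Q rs} d := by
      refine ⟨⟨gs, h1, h2, h5⟩, ?_⟩
      rintro k ⟨rs, b1, b2, b3⟩
      have := depth_le_dim (k := k) gQ ⟨rs, b1, b2, b3.toIsWeaklyRegular⟩
      change _ ≤ mdim _ Q at this
      rw [heq] at this
      exact_mod_cast this
    exact hgr.csSup_eq
  rw [this]

variable {M N : Type} [AddCommGroup M] [Module (MvPolynomial (Fin n) K) M]
    [Module K M] [IsScalarTower K (MvPolynomial (Fin n) K) M]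
    [AddCommGroup N] [Module (MvPolynomial (Fin n) K) N] [Module K N]
    [IsScalarTower K (MvPolynomial (Fin n) K) N]

theorem tmul_inj (t : Fin n → ℕ) (ht : ∀ i, 1 ≤ t i) {a b : Fin n → ℕ} : t * a = t * b ↔ a = b := by
  constructor
  · intro h
    ext i
    have := congrFun h i
    simp only [Pi.mul_apply] at this
    exact Nat.eq_of_mul_eq_mul_left (ht i) this
  · rintro rfl; rfl

theorem exists_psi (t : Fin n → ℕ) (ht : ∀ i, 1 ≤ t i)
    (G : MultiGrading K n M) (hM : PosDetermined G t)
    (H : MultiGrading K n N) (hN : IsRStar t G H) :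
    ∃ ψ : N →ₗ[K] M, Function.Injective ψ ∧ (∀ s z, ψ (s • z) = phi K t s • ψ z) ∧
      (∀ a, ∀ z ∈ H.g a, ψ z ∈ G.g (t * a)) ∧
      (∀ a z, G.p (t * a) (ψ z) = ψ (H.p a z)) ∧
      (∀ a, ∀ m ∈ G.g (t * a), ∃ z, ψ z = m) := by
  obtain ⟨e, e1, e2, e3⟩ := hN
  have hmem : ∀ a, ∀ x ∈ G.g (rmap t a), e a x ∈ H.g a := by
    intro a x hx
    have : e a x ∈ (H.g a : Set N) := by rw [← e2 a]; exact ⟨x, hx, rfl⟩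
    exact this
  have hbij : ∀ a, Function.Bijective ((e a).restrict (hmem a)) := by
    intro a
    constructor
    · intro x y hxy
      exact Subtype.ext (e1 a x.2 y.2 (congrArg Subtype.val hxy))
    · rintro ⟨y, hy⟩
      have : y ∈ e a '' (G.g (rmap t a)) := by rw [e2 a]; exact hy
      obtain ⟨x, hx, rfl⟩ := this
      exact ⟨⟨x, hx⟩, rfl⟩
  let E := fun a => LinearEquiv.ofBijective _ (hbij a)
  obtain ⟨ψ, hψ⟩ := H.exists_lift (fun a =>
    ((LinearMap.lsmul (MvPolynomial (Fin n) K) M (mono K (t * a - rmap t a))).restrictScalars K) ∘ₗ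
      (G.g (rmap t a)).subtype ∘ₗ (E a).symm.toLinearMap)
  have key : ∀ a, ∀ m ∈ G.g (rmap t a), ψ (e a m) = mono K (t * a - rmap t a) • m := by
    intro a m hm
    have h1 := hψ a ⟨e a m, hmem a m hm⟩
    have h2 : (E a).symm ⟨e a m, hmem a m hm⟩ = ⟨m, hm⟩ := by
      rw [LinearEquiv.symm_apply_eq]; rfl
    rw [h1]
    simp [h2]
  have hsurj : ∀ a, ∀ z ∈ H.g a, ∃ m ∈ G.g (rmap t a), e a m = z := by
    intro a z hz
    have : z ∈ e a '' (G.g (rmap t a)) := by rw [e2 a]; exact hz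
    exact this
  have hb : ∀ a, Set.BijOn (fun m => mono K (t * a - rmap t a) • m) (G.g (rmap t a) : Set M)
      (G.g (t * a) : Set M) := by
    intro a
    have := posdet_iter G t hM _ (rmap t a) (t * a - rmap t a) rfl (by
      intro i hi
      simp only [rmap, Pi.sub_apply, Pi.mul_apply] at hi ⊢
      split_ifs at hi ⊢ with h
      · exact le_rfl
      · have : a i = 0 := by omega
        simp [this] at hi)
    rwa [add_tsub_cancel_of_le (rmap_le t a)] at this
  have hdeg : ∀ a, ∀ z ∈ H.g a, ψ z ∈ G.g (t * a) := by
    intro a z hz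
    obtain ⟨m, hm, rfl⟩ := hsurj a z hz
    rw [key a m hm]
    exact (hb a).mapsTo hm
  have hp : ∀ a z, G.p (t * a) (ψ z) = ψ (H.p a z) := by
    intro a z
    refine H.ind (P := fun z => G.p (t * a) (ψ z) = ψ (H.p a z)) (by simp) ?_ ?_ z
    · intro x y hx hy; simp only [map_add, hx, hy]
    · intro b m hm
      rw [H.p_hom _ hm, G.p_hom _ (hdeg b m hm)]
      simp only [tmul_inj t ht]
      split_ifs <;> simp
  refine ⟨ψ, ?_, ?_, hdeg, hp, ?_⟩
  · rw [injective_iff_map_eq_zero]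
    intro z hz
    have : z ∈ (⊥ : Submodule K N) := by
      refine H.mem_of_p _ z fun a => ?_
      rw [Submodule.mem_bot]
      have h1 := hp a z
      rw [hz, map_zero] at h1
      obtain ⟨m, hm, hm'⟩ := hsurj a _ (H.p_mem a z)
      rw [← hm', key a m hm] at h1
      have : m = 0 := (hb a).injOn hm (zero_mem _) (by simpa using h1.symm)
      rw [← hm', this, map_zero]
    simpa using this
  · intro s z
    induction s using MvPolynomial.induction_on' with
    | add p q hp hq => simp only [add_smul, map_add, hp, hq]
    | monomial u k =>
      rw [monomial_eq_smul_mono, smul_assoc, map_smul ψ, map_smul (phi K t), smul_assoc, phi_mono]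
      congr 1
      generalize (u : Fin n → ℕ) = u
      refine H.ind (P := fun z => ψ (mono K u • z) = mono K (t * u) • ψ z)
        (by simp) ?_ ?_ z
      · intro x y hx hy; simp only [map_add, smul_add, hx, hy]
      · intro a z hz
        obtain ⟨m, hm, rfl⟩ := hsurj a z hz
        rw [← e3 a u m hm, key a m hm, key, smul_smul, smul_smul, ← mono_add', ← mono_add']
        · congr 2
          ext i
          have h1 := rmap_le t a i
          have h2 := rmap_le t (a + u) i
          have h3 := rmap_mono t a u i
          simp only [Pi.add_apply, Pi.sub_apply, Pi.mul_apply] at *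
          rw [mul_add] at *
          omega
        · have := G.compat _ (rmap t (a + u) - rmap t a) m hm
          rwa [add_tsub_cancel_of_le (rmap_mono t a u)] at this
  · intro a m hm
    obtain ⟨m', hm', rfl⟩ := (hb a).surjOn hm
    exact ⟨e a m', key a m' hm'⟩

theorem exists_pi (t : Fin n → ℕ) (ht : ∀ i, 1 ≤ t i)
    (G : MultiGrading K n M) (H : MultiGrading K n N) (ψ : N →ₗ[K] M)
    (hinj : Function.Injective ψ) (hψ : ∀ s z, ψ (s • z) = phi K t s • ψ z)
    (hdeg : ∀ a, ∀ z ∈ H.g a, ψ z ∈ G.g (t * a))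
    (hsurj : ∀ a, ∀ m ∈ G.g (t * a), ∃ z, ψ z = m) :
    ∃ π : M →+ N, (∀ s m, π (phi K t s • m) = s • π m) ∧ (∀ z, π (ψ z) = z) ∧
      ∀ c, IsGr G c → ∀ m ∈ c, ψ (π m) ∈ c := by
  classical
  obtain ⟨P, hP⟩ := G.exists_lift (fun b => if ∃ a, b = t * a then (G.g b).subtype else 0)
  have hP1 : ∀ b, ∀ m ∈ G.g b, P m = if ∃ a, b = t * a then m else 0 := by
    intro b m hm
    have := hP b ⟨m, hm⟩
    rw [this]
    split_ifs <;> simp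
  have hrange : ∀ m, P m ∈ LinearMap.range ψ := by
    intro m
    refine G.ind (P := fun m => P m ∈ LinearMap.range ψ) (by simp) ?_ ?_ m
    · intro x y hx hy; rw [map_add]; exact add_mem hx hy
    · intro b m hm
      rw [hP1 b m hm]
      split_ifs with h
      · obtain ⟨a, rfl⟩ := h
        exact hsurj a m hm
      · exact zero_mem _
  have hPψ : ∀ z, P (ψ z) = ψ z := by
    intro z
    refine H.ind (P := fun z => P (ψ z) = ψ z) (by simp) ?_ ?_ z
    · intro x y hx hy; simp only [map_add, hx, hy]
    · intro a z hz
      rw [hP1 _ _ (hdeg a z hz), if_pos ⟨a, rfl⟩]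
  have hPs : ∀ s m, P (phi K t s • m) = phi K t s • P m := by
    intro s m
    induction s using MvPolynomial.induction_on' with
    | add p q hp hq => simp only [add_smul, map_add, hp, hq]
    | monomial u k =>
      rw [monomial_eq_smul_mono, map_smul (phi K t), smul_assoc, map_smul P, smul_assoc, phi_mono]
      congr 1
      generalize (u : Fin n → ℕ) = u
      refine G.ind (P := fun m => P (mono K (t * u) • m) = mono K (t * u) • P m)
        (by simp) ?_ ?_ m
      · intro x y hx hy; simp only [map_add, smul_add, hx, hy]
      · intro b m hm
        rw [hP1 b m hm, hP1 _ _ (G.compat b _ m hm)]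
        have : (∃ a, b + t * u = t * a) ↔ ∃ a, b = t * a := by
          constructor
          · rintro ⟨a, ha⟩
            refine ⟨a - u, ?_⟩
            ext i
            have := congrFun ha i
            simp only [Pi.add_apply, Pi.mul_apply, Pi.sub_apply] at this ⊢
            rw [Nat.mul_sub]
            omega
          · rintro ⟨a, rfl⟩
            exact ⟨a + u, by rw [mul_add]⟩
        simp only [this]
        split_ifs <;> simp
  have hPp : ∀ b m, G.p b (P m) = P (G.p b m) := by
    intro b m
    refine G.ind (P := fun m => G.p b (P m) = P (G.p b m)) (by simp) ?_ ?_ m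
    · intro x y hx hy; simp only [map_add, hx, hy]
    · intro d m hm
      rw [hP1 d m hm, G.p_hom _ hm]
      by_cases h : d = b
      · subst h
        rw [if_pos rfl, hP1 d m hm]
        split_ifs
        · rw [G.p_hom _ hm, if_pos rfl]
        · simp
      · rw [if_neg h, map_zero]
        split_ifs
        · rw [G.p_hom _ hm, if_neg h]
        · simp
  choose π hπ using hrange
  refine ⟨⟨⟨π, ?_⟩, ?_⟩, ?_, ?_, ?_⟩
  · apply hinj; simp [hπ]
  · intro x y; apply hinj; simp [hπ]
  · intro s m
    apply hinj
    change ψ (π _) = ψ (s • π m)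
    rw [hπ, hψ, hπ, hPs]
  · intro z
    apply hinj
    change ψ (π _) = _
    rw [hπ, hPψ]
  · intro c hc m hm
    change ψ (π _) ∈ _
    rw [hπ]
    refine G.mem_of_p _ _ fun b => ?_
    rw [hPp, hP1 b _ (G.p_mem b m)]
    split_ifs
    · exact hc m hm b
    · exact zero_mem _

theorem strict_subseq {α : Type} [PartialOrder α] : ∀ (r : ℕ) (c : Fin (r + 1) → α)
    (_ : ∀ i : Fin r, c i.castSucc ≤ c i.succ),
    ∃ (r' : ℕ) (e : Fin r' → Fin r) (c' : Fin (r' + 1) → α), StrictMono e ∧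
      c' 0 = c 0 ∧ c' (Fin.last r') = c (Fin.last r) ∧
      (∀ i, c' i.castSucc = c (e i).castSucc) ∧ (∀ i, c' i.succ = c (e i).succ) ∧
      (∀ i : Fin r', c' i.castSucc < c' i.succ) ∧ (∀ j, c' j ∈ Set.range c) := by
  intro r
  induction r with
  | zero =>
    intro c _
    exact ⟨0, id, c, strictMono_id, rfl, rfl, fun i => i.elim0, fun i => i.elim0,
      fun i => i.elim0, fun j => ⟨j, rfl⟩⟩
  | succ r ih =>
    intro c hc
    obtain ⟨r', e, c', h1, h2, h3, h4, h5, h6, h7⟩ := ih (fun i => c i.castSucc)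
      (fun i => by simpa using hc i.castSucc)
    have hl := hc (Fin.last r)
    rcases hl.eq_or_lt with hl | hl
    · refine ⟨r', fun i => (e i).castSucc, c', fun i j hij => h1 hij, h2, ?_, h4, ?_, h6, ?_⟩
      · rw [h3, hl]; rfl
      · intro i; rw [h5]; rfl
      · intro j
        obtain ⟨k, hk⟩ := h7 j
        exact ⟨_, hk⟩
    · refine ⟨r' + 1, Fin.snoc (α := fun _ => Fin (r + 1)) (fun i => (e i).castSucc) (Fin.last r),
        Fin.snoc (α := fun _ => α) c' (c (Fin.last (r + 1))), ?_, ?_, ?_, ?_, ?_, ?_, ?_⟩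
      · intro i j
        refine Fin.lastCases ?_ (fun j => ?_) j
        · refine Fin.lastCases (fun h => absurd h (lt_irrefl _)) (fun i _ => ?_) i
          simp only [Fin.snoc_castSucc, Fin.snoc_last]
          exact Fin.castSucc_lt_last _
        · refine Fin.lastCases (fun h => absurd h (by simp [Fin.le_last])) (fun i hij => ?_) i
          simp only [Fin.snoc_castSucc]
          exact h1 hij
      · have : (0 : Fin (r' + 1 + 1)) = Fin.castSucc 0 := rfl
        rw [this, Fin.snoc_castSucc, h2]; rfl
      · rw [Fin.snoc_last]
      · intro i
        refine Fin.lastCases ?_ (fun i => ?_) i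
        · simp only [Fin.snoc_castSucc, Fin.snoc_last]; exact h3
        · simp only [Fin.snoc_castSucc]; exact h4 i
      · intro i
        refine Fin.lastCases ?_ (fun i => ?_) i
        · simp only [Fin.succ_last, Fin.snoc_last]
        · simp only [Fin.succ_castSucc, Fin.snoc_castSucc]; exact h5 i
      · intro i
        refine Fin.lastCases ?_ (fun i => ?_) i
        · simp only [Fin.succ_last, Fin.snoc_castSucc, Fin.snoc_last]
          rw [h3]; exact hl
        · simp only [Fin.succ_castSucc, Fin.snoc_castSucc]; exact h6 i
      · intro j
        refine Fin.lastCases ?_ (fun i => ?_) j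
        · rw [Fin.snoc_last]; exact ⟨_, rfl⟩
        · rw [Fin.snoc_castSucc]
          obtain ⟨k, hk⟩ := h7 i
          exact ⟨_, hk⟩

theorem sq_good (G : MultiGrading K n M) (c c' : Submodule (MvPolynomial (Fin n) K) M)
    (hc : IsGr G c) (f : MvPolynomial (Fin n) K) (z : subquotient c c') (hf : f ∉ mm K n)
    (hz : f • z = 0) : z = 0 := by
  obtain ⟨z, rfl⟩ := Submodule.Quotient.mk_surjective _ z
  rw [← Submodule.Quotient.mk_smul, Submodule.Quotient.mk_eq_zero] at hz
  rw [Submodule.Quotient.mk_eq_zero]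
  exact gr_good G c hc f z hf hz

end RStar

/-- if `M` is sequentially Cohen-Macaulay and `r^*M ≠ 0`, then `r^*M` is
sequentially Cohen-Macaulay. -/
theorem rstar_seqCM {M N : Type} [AddCommGroup M] [Module (MvPolynomial (Fin n) K) M]
    [Module K M] [IsScalarTower K (MvPolynomial (Fin n) K) M]
    [AddCommGroup N] [Module (MvPolynomial (Fin n) K) N] [Module K N]
    [IsScalarTower K (MvPolynomial (Fin n) K) N]
    (t : Fin n → ℕ) (ht : ∀ i, 1 ≤ t i)
    (G : MultiGrading K n M) [Module.Finite (MvPolynomial (Fin n) K) M]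
    (hM : PosDetermined G t)
    (H : MultiGrading K n N) (hN : IsRStar t G H) (hN0 : Nontrivial N)
    (hseq : IsSeqCM G) :
    IsSeqCM H := by
  obtain ⟨ψ, hinj, hψ, hdeg, hp, hsurj⟩ := exists_psi t ht G hM H hN
  obtain ⟨π, hπ, hπψ, hψπ⟩ := exists_pi t ht G H ψ hinj hψ hdeg hsurj
  obtain ⟨r, c, c0, cl, cs, cg, ccm, cd⟩ := hseq
  replace cg : ∀ j, IsGr G (c j) := fun j => (IsGr_iff G _).1 (cg j)
  let d : Fin (r + 1) → Submodule (MvPolynomial (Fin n) K) N := fun j =>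
    { carrier := {z | ψ z ∈ c j}
      add_mem' := fun {x y} hx hy => by
        rw [Set.mem_setOf_eq, map_add]; exact add_mem hx hy
      zero_mem' := by simp
      smul_mem' := fun s x hx => by
        rw [Set.mem_setOf_eq, hψ]; exact (c j).smul_mem _ hx }
  have hd : ∀ j z, z ∈ d j ↔ ψ z ∈ c j := fun j z => Iff.rfl
  have hdg : ∀ j, IsGr H (d j) := by
    intro j z hz a
    rw [hd, ← hp]
    exact cg j _ hz _
  have hdm : ∀ i : Fin r, d i.castSucc ≤ d i.succ := fun i z hz => (cs i).le hz
  have main : ∀ i : Fin r, d i.castSucc < d i.succ →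
      IsCM K n (subquotient (d i.castSucc) (d i.succ)) ∧
      mdim (MvPolynomial (Fin n) K) (subquotient (d i.castSucc) (d i.succ)) =
        mdim (MvPolynomial (Fin n) K) (subquotient (c i.castSucc) (c i.succ)) := by
    intro i hi
    have hnt : Nontrivial (subquotient (d i.castSucc) (d i.succ)) := by
      rw [Submodule.Quotient.nontrivial_iff]
      intro htop
      refine hi.not_ge fun z hz => ?_
      have : (⟨z, hz⟩ : d i.succ) ∈ Submodule.comap (d i.succ).subtype (d i.castSucc) := by
        rw [htop]; trivial
      exact this
    let ψ0 : d i.succ →+ c i.succ :=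
      { toFun := fun z => ⟨ψ z, z.2⟩
        map_zero' := by ext; simp
        map_add' := fun x y => by ext; simp }
    let π0 : c i.succ →+ d i.succ :=
      { toFun := fun m => ⟨π m, hψπ _ (cg _) m m.2⟩
        map_zero' := by ext; simp
        map_add' := fun x y => by ext; simp }
    let ψ1 : subquotient (d i.castSucc) (d i.succ) →+ subquotient (c i.castSucc) (c i.succ) :=
      QuotientAddGroup.map _ _ ψ0 (fun z hz => hz)
    let π1 : subquotient (c i.castSucc) (c i.succ) →+ subquotient (d i.castSucc) (d i.succ) :=
      QuotientAddGroup.map _ _ π0 (fun z hz => hψπ _ (cg _) z hz)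
    refine cm_retract t ht (sq_good G _ _ (cg _)) (sq_good H _ _ (hdg _)) ψ1 π1 ?_ ?_ ?_ (ccm i)
    · intro s q
      obtain ⟨q, rfl⟩ := Submodule.Quotient.mk_surjective _ q
      have : ψ0 (s • q) = phi K t s • ψ0 q := Subtype.ext (hψ s q)
      exact congrArg Submodule.Quotient.mk this
    · intro s q
      obtain ⟨q, rfl⟩ := Submodule.Quotient.mk_surjective _ q
      have : π0 (phi K t s • q) = s • π0 q := Subtype.ext (hπ s q)
      exact congrArg Submodule.Quotient.mk this
    · intro q
      obtain ⟨q, rfl⟩ := Submodule.Quotient.mk_surjective _ q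
      have : π0 (ψ0 q) = q := Subtype.ext (hπψ q)
      exact congrArg Submodule.Quotient.mk this
  obtain ⟨r', e, d', h1, h2, h3, h4, h5, h6, h7⟩ := strict_subseq r d hdm
  have hlt : ∀ i, d (e i).castSucc < d (e i).succ := fun i => by
    rw [← h4, ← h5]; exact h6 i
  refine ⟨r', d', ?_, ?_, h6, ?_, ?_, ?_⟩
  · rw [h2, eq_bot_iff]
    intro z hz
    rw [hd, c0, Submodule.mem_bot] at hz
    rw [Submodule.mem_bot]
    exact hinj (by rw [hz, map_zero])
  · rw [h3, eq_top_iff]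
    intro z _
    rw [hd, cl]
    trivial
  · intro j
    rw [IsGr_iff]
    obtain ⟨k, hk⟩ := h7 j
    rw [← hk]
    exact hdg k
  · intro i
    rw [h4, h5]
    exact (main (e i) (hlt i)).1
  · intro i j hij
    rw [h4, h5, h4, h5, (main (e i) (hlt i)).2, (main (e j) (hlt j)).2]
    exact cd _ _ (h1 hij)
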